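/- Let p > 3 be a prime. Then ∑_{k=0}^{p-1} (2k+1)(-1)^k D_k ≡ p - (7/12) p⁴ B_{p-3} (mod p⁵), i.e., the p-adic valuation of ∑_{k=0}^{p-1} (2k+1)(-1)^k D_k - p + (7/12) p⁴ B_{p-3} (a rational number whose denominator is not divisible by p) is at least 5. -/

import Mathlib

/-- The central Delannoy number `D_n = ∑_{k=0}^n C(n,k) C(n+k,k)`. -/
def delannoy (n : ℕ) : ℤ :=
  ∑ k ∈ Finset.range (n + 1), (n.choose k : ℤ) * ((n + k).choose k : ℤ)

open Finset in
/-- Telescoping evaluation of `∑ (2k+1) (-1)^k C(k+j, 2j)`. -/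
theorem sum_odd_mul_neg_one_pow_mul_choose (n j : ℕ) :
    ∑ k ∈ range (n + 1), (2 * (k : ℤ) + 1) * (-1) ^ k * ((k + j).choose (2 * j) : ℤ) =
      (-1) ^ n * (((n : ℤ) + 1 - j) * ((n + 1 + j).choose (2 * j) : ℤ)) := by
  have step (n : ℕ) : ((n : ℤ) + 1 - j) * ((n + 1 + j).choose (2 * j) : ℤ) =
      (n + 1 + j) * ((n + j).choose (2 * j) : ℤ) := by
    rcases le_or_gt j (n + 1) with h | h
    · have := Nat.choose_mul_succ_eq (n + j) (2 * j)
      have h2 : n + j + 1 - 2 * j = n + 1 - j := by omega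
      rw [h2, show n + j + 1 = n + 1 + j by ring] at this
      zify [h] at this
      linear_combination -this
    · rw [Nat.choose_eq_zero_of_lt (by omega), Nat.choose_eq_zero_of_lt (by omega)]
      simp
  induction n with
  | zero =>
    rw [step 0]
    rcases Nat.eq_zero_or_pos j with rfl | h
    · simp
    · simp [Nat.choose_eq_zero_of_lt (show j < 2 * j by omega)]
  | succ n ih =>
    rw [sum_range_succ, ih, step (n + 1)]
    push_cast
    ring

theorem choose_mul_choose_add (k j : ℕ) :
    k.choose j * (k + j).choose j = (k + j).choose (2 * j) * (2 * j).choose j := by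
  rcases le_or_gt j k with h | h
  · rw [Nat.choose_mul, Nat.add_sub_cancel, show 2 * j - j = j by omega, mul_comm]
    omega
  · rw [Nat.choose_eq_zero_of_lt h, Nat.choose_eq_zero_of_lt (show k + j < 2 * j by omega)]
    simp

open Finset in
/-- Closed form of the weighted alternating sum of central Delannoy numbers. -/
theorem sum_delannoy_eq (n : ℕ) :
    ∑ k ∈ range (n + 1), (2 * (k : ℤ) + 1) * (-1) ^ k * delannoy k =
      (-1) ^ n * ((n + 1) *
        ∑ j ∈ range (n + 1), (n.choose j : ℤ) * ((n + 1 + j).choose j : ℤ)) := by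
  have hD (k : ℕ) (hk : k ∈ range (n + 1)) : delannoy k =
      ∑ j ∈ range (n + 1), ((k + j).choose (2 * j) : ℤ) * ((2 * j).choose j : ℤ) := by
    rw [delannoy]
    have : range (k + 1) ⊆ range (n + 1) := by
      intro x; simp only [mem_range] at *; omega
    rw [sum_subset this]
    · exact sum_congr rfl fun j _ => mod_cast choose_mul_choose_add k j
    · intro j _ hj
      rw [mem_range, not_lt] at hj
      rw [Nat.choose_eq_zero_of_lt (by omega)]
      simp
  rw [sum_congr rfl fun k hk => by rw [hD k hk, mul_sum], sum_comm, mul_sum, mul_sum]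
  refine sum_congr rfl fun j hj => ?_
  simp_rw [← mul_assoc]
  rw [← sum_mul, sum_odd_mul_neg_one_pow_mul_choose]
  have h1 : ((n + 1).choose j : ℤ) * ((n + 1 + j).choose j : ℤ) =
    ((n + 1 + j).choose (2 * j) : ℤ) * ((2 * j).choose j : ℤ) :=
    mod_cast choose_mul_choose_add (n + 1) j
  have h2 : (n.choose j : ℤ) * (n + 1) = ((n + 1).choose j : ℤ) * (n + 1 - j) := by
    have := Nat.choose_mul_succ_eq n j
    rw [mem_range] at hj
    zify [show j ≤ n + 1 by omega] at this
    exact this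
  linear_combination (-1) ^ n * (-((n : ℤ) + 1 - j) * h1 - ((n + 1 + j).choose j : ℤ) * h2)

section CommRing

open Finset

variable {R : Type*} [CommRing R]

theorem choose_mul_choose_modEq {n : ℕ} {u : ℕ → R}
    (hu : ∀ i, 0 < i → i < n + 1 → (i : R) * u i = 1) (j : ℕ) (hj : j < n + 1) :
    ((n + 1 : ℕ) : R) ^ 4 ∣ (n.choose j : R) * ((n + 1 + j).choose j : R) -
      (-1) ^ j * (1 - ((n + 1 : ℕ) : R) ^ 2 * ∑ i ∈ range j, u (i + 1) ^ 2) := by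
  induction j with
  | zero => simp
  | succ j ih =>
    obtain ⟨c, hc⟩ := ih (by omega)
    have h1 : (n.choose (j + 1) : R) * (j + 1) = n.choose j * (n - j) := by
      have := Nat.choose_succ_right_eq n j
      rw [← Nat.cast_sub (by omega)]
      exact_mod_cast congrArg (Nat.cast : ℕ → R) this
    have h2 : ((n + 1 + (j + 1)).choose (j + 1) : R) * (j + 1) =
        (n + 1 + j).choose j * (n + 1 + j + 1) := by
      have := Nat.add_one_mul_choose_eq (n + 1 + j) j
      have := congrArg (Nat.cast : ℕ → R) this
      push_cast at this
      rw [show n + 1 + (j + 1) = n + 1 + j + 1 by ring]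
      linear_combination -this
    have hj1 := hu (j + 1) (by omega) hj
    rw [sum_range_succ]
    push_cast at hc hj1 ⊢
    set s := ∑ i ∈ range j, u (i + 1) ^ 2
    set v := u (j + 1)
    set A := (n.choose j : R)
    set B := ((n + 1 + j).choose j : R)
    set A' := (n.choose (j + 1) : R)
    set B' := ((n + 1 + (j + 1)).choose (j + 1) : R)
    have h3 : A' * B' = A * B * (((n : R) + 1) ^ 2 * v ^ 2 - 1) := by
      have hA : A' = A * (n - j) * v := by linear_combination v * h1 - A' * hj1
      have hB : B' = B * (n + 1 + j + 1) * v := by linear_combination v * h2 - B' * hj1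
      rw [hA, hB]
      linear_combination (-A * B * (((j : R) + 1) * v + 1)) * hj1
    refine ⟨c * (((n : R) + 1) ^ 2 * v ^ 2 - 1) - (-1) ^ j * s * v ^ 2, ?_⟩
    rw [h3]
    linear_combination (((n : R) + 1) ^ 2 * v ^ 2 - 1) * hc

theorem sum_neg_one_pow_mul_sum_range (f : ℕ → R) (m : ℕ) :
    ∑ j ∈ range (2 * m + 1), (-1) ^ j * ∑ i ∈ range j, f (i + 1) =
      ∑ i ∈ range m, f (2 * (i + 1)) := by
  induction m with
  | zero => simp
  | succ m ih =>
    rw [show 2 * (m + 1) + 1 = 2 * m + 1 + 1 + 1 by ring, sum_range_succ, sum_range_succ, ih,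
      sum_range_succ _ m, sum_range_succ _ (2 * m + 1)]
    rw [show 2 * m + 1 + 1 = 2 * (m + 1) by ring]
    simp [pow_succ, pow_mul]

theorem sum_range_two_mul_eq_halves (f : ℕ → R) (m : ℕ) :
    ∑ i ∈ range (2 * m), f (i + 1) =
      ∑ i ∈ range m, (f (i + 1) + f (2 * m + 1 - (i + 1))) := by
  rw [two_mul, sum_range_add, sum_add_distrib]
  congr 1
  rw [← sum_range_reflect]
  refine sum_congr rfl fun i hi => ?_
  rw [mem_range] at hi
  congr 1
  omega

theorem sum_range_two_mul_eq_evens (f : ℕ → R) (m : ℕ) :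
    ∑ i ∈ range (2 * m), f (i + 1) =
      ∑ i ∈ range m, (f (2 * (i + 1)) + f (2 * m + 1 - 2 * (i + 1))) := by
  have h : ∑ i ∈ range m, f (2 * m + 1 - 2 * (i + 1)) = ∑ i ∈ range m, f (2 * i + 1) := by
    rw [← sum_range_reflect]
    refine sum_congr rfl fun i hi => ?_
    rw [mem_range] at hi
    congr 1
    omega
  rw [sum_add_distrib, h, ← sum_add_distrib]
  clear h
  induction m with
  | zero => simp
  | succ m ih =>
    rw [show 2 * (m + 1) = 2 * m + 1 + 1 by ring, sum_range_succ, sum_range_succ, ih,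
      sum_range_succ _ m]
    rw [show 2 * m + 1 + 1 = 2 * (m + 1) by ring]
    ring

/-- If `f (P - i)` is given to first order in `P = 2m + 1` by `f` and `g`, and both are
homogeneous under doubling, then the full sum of `f` has two expansions in terms of half sums. -/
theorem sum_modEq_half_sums {m : ℕ} {f g : ℕ → R} {a b c P : R}
    (hfg : ∀ i, 0 < i → i < 2 * m + 1 → P ^ 2 ∣ f (2 * m + 1 - i) - (f i + c * P * g i))
    (hf : ∀ i, 0 < i → i ≤ m → f (2 * i) = a * f i)
    (hg : ∀ i, 0 < i → i ≤ m → g (2 * i) = b * g i) :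
    P ^ 2 ∣ ∑ i ∈ range (2 * m), f (i + 1) -
      (2 * ∑ i ∈ range m, f (i + 1) + c * P * ∑ i ∈ range m, g (i + 1)) ∧
    P ^ 2 ∣ ∑ i ∈ range (2 * m), f (i + 1) -
      (2 * a * ∑ i ∈ range m, f (i + 1) + c * P * b * ∑ i ∈ range m, g (i + 1)) := by
  constructor
  · rw [sum_range_two_mul_eq_halves, mul_sum, mul_sum, ← sum_add_distrib, ← sum_sub_distrib]
    refine dvd_sum fun i hi => ?_
    rw [mem_range] at hi
    convert hfg (i + 1) (by omega) (by omega) using 1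
    ring
  · rw [sum_range_two_mul_eq_evens, mul_sum, mul_sum, ← sum_add_distrib, ← sum_sub_distrib]
    refine dvd_sum fun i hi => ?_
    rw [mem_range] at hi
    convert hfg (2 * (i + 1)) (by omega) (by omega) using 1
    rw [hf _ (by omega) (by omega), hg _ (by omega) (by omega)]
    ring

/-- The sum of inverse squares over even residues, in terms of a half sum of inverse cubes. -/
theorem sum_inv_sq_even_modEq {m : ℕ} (hm : 0 < m) {u : ℕ → R}
    (hu : ∀ i, 0 < i → i < 2 * m + 1 → (i : R) * u i = 1) :
    ((2 * m + 1 : ℕ) : R) ^ 2 ∣ 24 * ∑ i ∈ range m, u (2 * (i + 1)) ^ 2 +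
      7 * ((2 * m + 1 : ℕ) : R) * ∑ i ∈ range m, u (i + 1) ^ 3 := by
  have h2 : 2 * u 2 = 1 := mod_cast hu 2 (by omega) (by omega)
  have hdbl (i : ℕ) (h0 : 0 < i) (hi : i ≤ m) : u (2 * i) = u 2 * u i := by
    have e1 := hu i h0 (by omega)
    have e2 := hu (2 * i) (by omega) (by omega)
    push_cast at e2
    linear_combination u 2 * u i * e2 - u (2 * i) * (2 * u 2 * e1 + h2)
  obtain ⟨⟨x, hx⟩, ⟨y, hy⟩⟩ := sum_modEq_half_sums (m := m) (f := fun i => u i ^ 2)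
    (g := fun i => u i ^ 3) (a := u 2 ^ 2) (b := u 2 ^ 3) (c := 2) (P := ((2 * m + 1 : ℕ) : R))
    (fun i h0 hi => by
      have e1 := hu i h0 hi
      have e2 := hu (2 * m + 1 - i) (by omega) (by omega)
      rw [Nat.cast_sub hi.le] at e2
      set P := ((2 * m + 1 : ℕ) : R)
      set v := u (2 * m + 1 - i)
      have e3 : v = -u i - P * u i ^ 2 + P ^ 2 * u i ^ 2 * v := by
        have : v = P * u i * v - u i := by linear_combination -u i * e2 - v * e1
        linear_combination (1 + P * u i) * this
      set w := u i
      refine ⟨w ^ 4 + w ^ 2 * v * (-w - P * w ^ 2 + v), ?_⟩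
      linear_combination (v - w - P * w ^ 2) * e3)
    (fun i h0 hi => by simp only [hdbl i h0 hi]; ring)
    (fun i h0 hi => by simp only [hdbl i h0 hi]; ring)
  have hT : ∑ i ∈ range m, u (2 * (i + 1)) ^ 2 = u 2 ^ 2 * ∑ i ∈ range m, u (i + 1) ^ 2 := by
    rw [mul_sum]
    refine sum_congr rfl fun i hi => ?_
    rw [mem_range] at hi
    rw [hdbl _ (by omega) (by omega)]
    ring
  rw [hT]
  set F := ∑ i ∈ range m, u (i + 1) ^ 2
  set G := ∑ i ∈ range m, u (i + 1) ^ 3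
  set P := ((2 * m + 1 : ℕ) : R)
  have q2 : 4 * u 2 ^ 2 = 1 := by linear_combination (2 * u 2 + 1) * h2
  have q3 : 8 * u 2 ^ 3 = 1 := by linear_combination (4 * u 2 ^ 2 + 2 * u 2 + 1) * h2
  refine ⟨4 * (y - x), ?_⟩
  linear_combination 4 * (hy - hx) + 8 * F * q2 + P * G * q3

/-- A relation between a power sum and a half power sum of degree one less. -/
theorem sum_pow_modEq_half_sum_pow {m q : ℕ} (hq : Odd q) :
    ((2 * m + 1 : ℕ) : R) ^ 2 ∣
      (2 ^ (q + 1) - 1) * ∑ i ∈ range (2 * m), ((i + 1 : ℕ) : R) ^ (q + 1) +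
      ((q + 1 : ℕ) : R) * ((2 * m + 1 : ℕ) : R) * 2 ^ q *
        ∑ i ∈ range m, ((i + 1 : ℕ) : R) ^ q := by
  obtain ⟨⟨x, hx⟩, ⟨y, hy⟩⟩ := sum_modEq_half_sums (m := m) (f := fun i => (i : R) ^ (q + 1))
    (g := fun i => (i : R) ^ q) (a := 2 ^ (q + 1)) (b := 2 ^ q) (c := -((q + 1 : ℕ) : R))
    (P := ((2 * m + 1 : ℕ) : R))
    (fun i h0 hi => by
      obtain ⟨k, hk⟩ := Polynomial.powAddExpansion (-(i : R)) ((2 * m + 1 : ℕ) : R) (q + 1)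
      refine ⟨k, ?_⟩
      rw [Nat.cast_sub hi.le, sub_eq_neg_add ((2 * m + 1 : ℕ) : R), hk, hq.add_one.neg_pow, Nat.add_sub_cancel,
        hq.neg_pow]
      ring)
    (fun i _ _ => by push_cast; ring) (fun i _ _ => by push_cast; ring)
  refine ⟨2 ^ (q + 1) * x - y, ?_⟩
  linear_combination 2 ^ (q + 1) * hx - hy

end CommRing

section Padic

open Finset

variable {p : ℕ} [Fact p.Prime]

theorem PadicInt.isUnit_natCast_of_pos_of_lt {i : ℕ} (h0 : 0 < i) (hi : i < p) :
    IsUnit (i : ℤ_[p]) :=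
  PadicInt.isUnit_iff.mpr <| (PadicInt.norm_natCast_eq_one_iff).mpr <|
    Nat.coprime_of_lt_prime h0.ne' hi Fact.out

theorem exists_padicInt_bernoulli' (n : ℕ) (hn : n + 1 < p) :
    ∃ b : ℤ_[p], (b : ℚ_[p]) = (bernoulli' n : ℚ_[p]) := by
  induction n using Nat.strong_induction_on with
  | _ n ih =>
    have key : ((bernoulli' n : ℚ) : ℚ_[p]) ∈ PadicInt.subring p := by
      rw [bernoulli'_def]
      push_cast
      refine sub_mem (one_mem _) (sum_mem fun k hk => mul_mem ?_ ?_)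
      · rw [mem_range] at hk
        have hu := PadicInt.isUnit_natCast_of_pos_of_lt (p := p) (i := n - k + 1)
          (by omega) (by omega)
        obtain ⟨v, hv⟩ := hu.exists_right_inv
        have hv' := congrArg (fun x : ℤ_[p] => (x : ℚ_[p])) hv
        push_cast [Nat.cast_sub hk.le] at hv'
        rw [div_eq_mul_inv, inv_eq_of_mul_eq_one_right hv']
        exact mul_mem (natCast_mem _ _) v.2
      · rw [mem_range] at hk
        obtain ⟨b, hb⟩ := ih k hk (by omega)
        rw [← hb]
        exact b.2
    exact ⟨⟨_, key⟩, rfl⟩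

theorem exists_padicInt_bernoulli (n : ℕ) (hn : n + 1 < p) :
    ∃ b : ℤ_[p], (b : ℚ_[p]) = (bernoulli n : ℚ_[p]) := by
  obtain ⟨b, hb⟩ := exists_padicInt_bernoulli' n hn
  exact ⟨(-1) ^ n * b, by rw [bernoulli]; push_cast; rw [hb]⟩

theorem sum_pow_modEq_mul_bernoulli {q : ℕ} (hq : q + 1 < p) {b : ℤ_[p]}
    (hb : (b : ℚ_[p]) = (bernoulli q : ℚ_[p])) :
    (p : ℤ_[p]) ^ 2 ∣ ∑ k ∈ range p, (k : ℤ_[p]) ^ q - p * b := by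
  have hB (i : ℕ) : ∃ c : ℤ_[p], i + 1 < p → (c : ℚ_[p]) = (bernoulli i : ℚ_[p]) := by
    by_cases h : i + 1 < p
    · exact (exists_padicInt_bernoulli i h).imp fun _ h _ => h
    · exact ⟨0, fun h' => absurd h' h⟩
  choose c hc using hB
  have hcq : c q = b := Subtype.ext ((hc q hq).trans hb.symm)
  have faul : ((q + 1 : ℕ) : ℤ_[p]) * ∑ k ∈ range p, (k : ℤ_[p]) ^ q =
      ∑ i ∈ range (q + 1), c i * ((q + 1).choose i : ℤ_[p]) * (p : ℤ_[p]) ^ (q + 1 - i) := by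
    apply PadicInt.ext
    have := congrArg (Rat.cast : ℚ → ℚ_[p]) (sum_range_pow p q)
    push_cast at this ⊢
    rw [PadicInt.coe_sum, PadicInt.coe_sum]
    push_cast
    rw [this, mul_sum]
    refine sum_congr rfl fun i hi => ?_
    rw [mem_range] at hi
    rw [hc i (by omega)]
    have : (q : ℚ_[p]) + 1 ≠ 0 := by exact_mod_cast q.succ_ne_zero
    field_simp
  refine (PadicInt.isUnit_natCast_of_pos_of_lt (p := p) q.succ_pos hq).dvd_mul_left.mp ?_
  rw [Nat.succ_eq_add_one, mul_sub, faul, sum_range_succ, hcq, Nat.choose_succ_self_right,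
    Nat.add_sub_cancel_left]
  rw [show ∀ s t : ℤ_[p], s + b * t * (p : ℤ_[p]) ^ 1 - t * (p * b) = s from fun s t => by ring]
  refine dvd_sum fun i hi => Dvd.dvd.mul_left (pow_dvd_pow _ ?_) _
  rw [mem_range] at hi
  omega

theorem dvd_pow_sub_one_sub_one {i : ℕ} (h0 : 0 < i) (hi : i < p) :
    (p : ℤ_[p]) ∣ (i : ℤ_[p]) ^ (p - 1) - 1 := by
  have h := Int.ModEq.pow_card_sub_one_eq_one (Fact.out : p.Prime) (n := i)
    (Nat.isCoprime_iff_coprime.mpr (Nat.coprime_of_lt_prime h0.ne' hi Fact.out).symm)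
  have := map_dvd (Int.castRingHom ℤ_[p]) h.symm.dvd
  simpa using this

/-- The half sum of inverse cubes modulo `p` is `-2` times a Bernoulli number. -/
theorem sum_inv_cube_modEq_bernoulli {m : ℕ} (hm : 2 ≤ m) (hp : p = 2 * m + 1) {u : ℕ → ℤ_[p]}
    (hu : ∀ i, 0 < i → i < p → (i : ℤ_[p]) * u i = 1) {b : ℤ_[p]}
    (hb : (b : ℚ_[p]) = (bernoulli (p - 3) : ℚ_[p])) :
    (p : ℤ_[p]) ∣ 3 * ∑ i ∈ range m, u (i + 1) ^ 3 + 6 * b := by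
  have hp0 : (p : ℤ_[p]) ≠ 0 := by exact_mod_cast (Fact.out : p.Prime).ne_zero
  obtain ⟨q, hq⟩ : ∃ q, p = q + 4 := ⟨p - 4, by omega⟩
  have hodd : Odd q := by rw [Nat.odd_iff]; omega
  obtain ⟨x, hx⟩ := sum_pow_modEq_half_sum_pow (R := ℤ_[p]) (m := m) hodd
  obtain ⟨y, hy⟩ := sum_pow_modEq_mul_bernoulli (p := p) (q := q + 1) (by omega)
    (b := b) (by rw [hb, show p - 3 = q + 1 by omega])
  have hsum : ∑ k ∈ range p, (k : ℤ_[p]) ^ (q + 1) =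
      ∑ i ∈ range (2 * m), ((i + 1 : ℕ) : ℤ_[p]) ^ (q + 1) := by
    conv_lhs => rw [show range p = range (2 * m + 1) by rw [hp]]
    rw [sum_range_succ']
    simp
  have hG : (p : ℤ_[p]) ∣ ∑ i ∈ range m, ((i + 1 : ℕ) : ℤ_[p]) ^ q -
      ∑ i ∈ range m, u (i + 1) ^ 3 := by
    rw [← sum_sub_distrib]
    refine dvd_sum fun i hi => ?_
    rw [mem_range] at hi
    obtain ⟨z, hz⟩ := dvd_pow_sub_one_sub_one (p := p) (i := i + 1) (by omega) (by omega)
    have e := hu (i + 1) (by omega) (by omega)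
    refine ⟨u (i + 1) ^ 3 * z, ?_⟩
    rw [show p - 1 = q + 3 by omega] at hz
    set t := ((i + 1 : ℕ) : ℤ_[p])
    set w := u (i + 1)
    have e3 : t ^ 3 * w ^ 3 = 1 := by rw [← mul_pow, e, one_pow]
    linear_combination w ^ 3 * hz - t ^ q * e3
  obtain ⟨z, hz⟩ := hG
  obtain ⟨w, hw⟩ := dvd_pow_sub_one_sub_one (p := p) (i := 2) (by omega) (by omega)
  rw [show p - 1 = q + 3 by omega] at hw
  rw [← hp] at hx
  rw [hsum] at hy
  have hq' : ((q + 1 : ℕ) : ℤ_[p]) = p - 3 := by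
    rw [eq_sub_iff_add_eq]; exact_mod_cast hq.symm
  rw [hq'] at hx
  push_cast at hw
  set P := (p : ℤ_[p])
  set S := ∑ i ∈ range (2 * m), ((i + 1 : ℕ) : ℤ_[p]) ^ (q + 1)
  set G' := ∑ i ∈ range m, ((i + 1 : ℕ) : ℤ_[p]) ^ q
  set G := ∑ i ∈ range m, u (i + 1) ^ 3
  have h1 : (2 ^ (q + 1) - 1) * b + (P - 3) * 2 ^ q * G' = P * (x - (2 ^ (q + 1) - 1) * y) := by
    apply mul_left_cancel₀ hp0
    linear_combination hx - (2 ^ (q + 1) - 1) * hy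
  refine ⟨-8 * (x - (2 ^ (q + 1) - 1) * y) + 2 * w * b + G' + (P - 3) * w * G' - 3 * z, ?_⟩
  linear_combination -8 * h1 + (2 * b + (P - 3) * G') * hw - 3 * hz

end Padic

/-- For a prime `p > 3`,
`∑_{k=0}^{p-1} (2k+1)(-1)^k D_k ≡ p - (7/12) p⁴ B_{p-3} (mod p⁵)`,
i.e. the difference is `p⁵` times a `p`-adic integer. -/
theorem sum_two_k_add_one_neg_one_pow_delannoy (p : ℕ) [Fact p.Prime] (h3 : 3 < p) :
    ∃ z : ℤ_[p],
      ((∑ k ∈ Finset.range p, (2 * (k : ℤ) + 1) * (-1) ^ k * delannoy k : ℤ) : ℚ_[p]) -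
        (p : ℚ_[p]) + 7 / 12 * (p : ℚ_[p]) ^ 4 * (bernoulli (p - 3) : ℚ_[p]) =
      (p : ℚ_[p]) ^ 5 * z := by
  obtain ⟨m, hm⟩ := (Fact.out : p.Prime).odd_of_ne_two (by omega)
  have hunit (i : ℕ) : ∃ v : ℤ_[p], 0 < i → i < p → (i : ℤ_[p]) * v = 1 := by
    by_cases h : 0 < i ∧ i < p
    · exact (PadicInt.isUnit_natCast_of_pos_of_lt h.1 h.2).exists_right_inv.imp fun _ h _ _ => h
    · exact ⟨0, fun h0 hi => absurd ⟨h0, hi⟩ h⟩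
  choose u hu using hunit
  obtain ⟨b, hb⟩ := exists_padicInt_bernoulli (p := p) (p - 3) (by omega)
  obtain ⟨x, hx⟩ := sum_inv_cube_modEq_bernoulli (by omega) hm hu hb
  obtain ⟨y, hy⟩ := sum_inv_sq_even_modEq (R := ℤ_[p]) (m := m) (by omega) (by rwa [← hm])
  have hS := congrArg (Int.cast : ℤ → ℤ_[p]) (sum_delannoy_eq (2 * m))
  rw [← hm] at hS hy
  have hT : (p : ℤ_[p]) ^ 4 ∣
      ∑ j ∈ Finset.range p, ((2 * m).choose j : ℤ_[p]) * ((p + j).choose j : ℤ_[p]) -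
        (1 - (p : ℤ_[p]) ^ 2 * ∑ i ∈ Finset.range m, u (2 * (i + 1)) ^ 2) := by
    have h := Finset.dvd_sum fun j (hj : j ∈ Finset.range (2 * m + 1)) =>
      choose_mul_choose_modEq (R := ℤ_[p]) (n := 2 * m) (u := u) (by rwa [← hm]) j
        (Finset.mem_range.mp hj)
    rw [Finset.sum_sub_distrib] at h
    simp_rw [mul_sub, mul_left_comm _ (((2 * m + 1 : ℕ) : ℤ_[p]) ^ 2)] at h
    rw [Finset.sum_sub_distrib, ← Finset.mul_sum,
      sum_neg_one_pow_mul_sum_range fun i => u i ^ 2] at h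
    simp only [mul_one, ← hm] at h
    have h1 : ∑ j ∈ Finset.range p, (-1 : ℤ_[p]) ^ j = 1 := by
      rw [neg_one_geom_sum, if_neg (by rw [Nat.even_iff]; omega)]
    rwa [h1] at h
  obtain ⟨z, hz⟩ := hT
  have hpm : ((2 * m : ℕ) : ℤ_[p]) + 1 = p := by exact_mod_cast hm.symm
  push_cast at hS hpm
  rw [hpm, pow_mul, neg_one_sq, one_pow, one_mul] at hS
  have u2 := hu 2 (by omega) (by omega)
  have u3 := hu 3 (by omega) h3
  push_cast at u2 u3
  set T := ∑ i ∈ Finset.range m, u (2 * (i + 1)) ^ 2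
  set G := ∑ i ∈ Finset.range m, u (i + 1) ^ 3
  set P := (p : ℤ_[p])
  have h72 : 72 * (u 2 ^ 3 * u 3 ^ 2) = 1 := by
    rw [show 72 * (u 2 ^ 3 * u 3 ^ 2) = (2 * u 2) ^ 3 * (3 * u 3) ^ 2 by ring, u2, u3]
    norm_num
  have main : 72 * (P * (1 - P ^ 2 * T + P ^ 4 * z) - P) + 42 * P ^ 4 * b =
      72 * (P ^ 5 * (z - (u 2 ^ 3 * u 3 ^ 2) * (3 * y - 7 * x))) := by
    linear_combination -3 * P ^ 3 * hy + 7 * P ^ 4 * hx + P ^ 5 * (3 * y - 7 * x) * h72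
  refine ⟨z - (u 2 ^ 3 * u 3 ^ 2) * (3 * y - 7 * x), ?_⟩
  have hS' : ((∑ k ∈ Finset.range p, (2 * (k : ℤ) + 1) * (-1) ^ k * delannoy k : ℤ) : ℤ_[p]) =
      P * (1 - P ^ 2 * T + P ^ 4 * z) := by
    push_cast
    linear_combination hS + P * hz
  rw [← hS'] at main
  generalize z - (u 2 ^ 3 * u 3 ^ 2) * (3 * y - 7 * x) = w at main ⊢
  have main' := congrArg (PadicInt.Coe.ringHom : ℤ_[p] →+* ℚ_[p]) main
  simp only [P, map_add, map_sub, map_mul, map_pow, map_ofNat, map_natCast, map_intCast] at main'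
  rw [show PadicInt.Coe.ringHom b = (b : ℚ_[p]) from rfl,
    show PadicInt.Coe.ringHom w = (w : ℚ_[p]) from rfl] at main'
  rw [← hb]
  apply mul_left_cancel₀ (show (72 : ℚ_[p]) ≠ 0 by norm_num)
  linear_combination main'
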